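/- For every integer n ≥ 3 and every real z with 0 ≤ z < ρ = 1/(2(n + √(2n))), the series Â(z) = Σ_{m≥1} Â_{m,n} z^m converges and equals (2nz + 1 − √((4n² − 8n)z² − 4nz + 1))/(2(z+1)); moreover the series A(z) = Σ_{m≥1} A_{m,n} z^m converges for such z and satisfies A(z) = 2Â(z) − 2nz. -/

import Mathlib

/-- An and/or tree skeleton: leaves carry a variable index and a polarity
(`true` = positive literal, `false` = negated literal); internal nodes carry
a connective (`true` = AND, `false` = OR) and a list of children. -/
inductive AT (n : ℕ) : Type
  | leaf : Fin n → Bool → AT n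
  | node : Bool → List (AT n) → AT n

namespace AT

/-- The connective at the root, if the root is an internal node. -/
def rootConn {n : ℕ} : AT n → Option Bool
  | .leaf _ _ => none
  | .node c _ => some c

/-- Whether a tree is a single leaf. -/
def isLeafB {n : ℕ} : AT n → Bool
  | .leaf _ _ => true
  | .node _ _ => false

/-- The children of the root. -/
def rootChildren {n : ℕ} : AT n → List (AT n)
  | .leaf _ _ => []
  | .node _ ts => ts

/-- Well-formedness: an associative tree is a plane tree in which each internal
node has at least two children, no internal node has the same connective as its
parent (stratification), and leaves carry literals. -/
inductive WF {n : ℕ} : AT n → Prop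
  | leaf (i : Fin n) (b : Bool) : WF (.leaf i b)
  | node (c : Bool) (ts : List (AT n)) :
      2 ≤ ts.length → (∀ t ∈ ts, WF t) → (∀ t ∈ ts, rootConn t ≠ some c) →
      WF (.node c ts)

mutual
/-- The size of a tree: its total number of nodes. -/
def size {n : ℕ} : AT n → ℕ
  | .leaf _ _ => 1
  | .node _ ts => 1 + sizeList ts
def sizeList {n : ℕ} : List (AT n) → ℕ
  | [] => 0
  | t :: ts => size t + sizeList ts
end

mutual
/-- The Boolean function computed by a tree. -/
def eval {n : ℕ} : AT n → (Fin n → Bool) → Bool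
  | .leaf i b, x => if b then x i else ! x i
  | .node c ts, x => evalList c ts x
def evalList {n : ℕ} : Bool → List (AT n) → (Fin n → Bool) → Bool
  | c, [], _ => c
  | c, t :: ts, x => if c then eval t x && evalList c ts x
                     else eval t x || evalList c ts x
end

end AT

open AT

/-- Number of associative trees of size `m` in a family `𝒯`. -/
noncomputable def countIn (n : ℕ) (𝒯 : Set (AT n)) (m : ℕ) : ℕ :=
  Nat.card {t : AT n // t ∈ 𝒯 ∧ WF t ∧ size t = m}

/-- `A n m` is the number of associative trees of size `m` on `n` variables. -/
noncomputable def A (n m : ℕ) : ℕ := countIn n Set.univ m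

/-- `Pmn n m f` is the proportion, among associative trees of size `m` on `n`
variables, of those computing the Boolean function `f`. -/
noncomputable def Pmn (n m : ℕ) (f : (Fin n → Bool) → Bool) : ℝ :=
  (countIn n {t | eval t = f} m : ℝ) / (A n m : ℝ)

/-- Ratio of trees of size `m` in the family `𝒯` among all trees of size `m`. -/
noncomputable def ratio (n : ℕ) (𝒯 : Set (AT n)) (m : ℕ) : ℝ :=
  (countIn n 𝒯 m : ℝ) / (A n m : ℝ)

/-- `HasLimRatio n 𝒯 μ` : the limiting ratio of the family `𝒯` exists and is `μ`. -/
def HasLimRatio (n : ℕ) (𝒯 : Set (AT n)) (μ : ℝ) : Prop :=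
  Filter.Tendsto (ratio n 𝒯) Filter.atTop (nhds μ)

/-- Extension of a Boolean function of `n₀` variables to `n ≥ n₀` variables. -/
def extend {n₀ n : ℕ} (h : n₀ ≤ n) (f : (Fin n₀ → Bool) → Bool) :
    (Fin n → Bool) → Bool :=
  fun x => f (fun j => x (Fin.castLE h j))

open Classical in
/-- The tree size complexity of a Boolean function. -/
noncomputable def Lcomp (n : ℕ) (f : (Fin n → Bool) → Bool) : ℕ :=
  if f = (fun _ => true) ∨ f = (fun _ => false) then 0
  else if ∃ i : Fin n, f = (fun x => x i) ∨ f = (fun x => ! x i) then 2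
  else sInf {m | ∃ t : AT n, WF t ∧ size t = m ∧ eval t = f}

/-- `Ahat n m` : the number of associative trees of size `m` on `n` variables that
are either a single leaf or have root labelled `∧`. -/
noncomputable def Ahat (n m : ℕ) : ℕ :=
  countIn n {t | rootConn t ≠ some false} m

/-- The dominant singularity `ρ = 1/(2(n + √(2n)))`. -/
noncomputable def rho (n : ℕ) : ℝ := 1 / (2 * ((n : ℝ) + Real.sqrt (2 * n)))

open scoped ENNReal Classical in
/-- Weight of a tree, restricted to a predicate. -/
noncomputable def wt {n : ℕ} (z : ℝ≥0∞) (p : AT n → Prop) (t : AT n) : ℝ≥0∞ :=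
  if p t then z ^ size t else 0

section helpers
open scoped ENNReal

theorem prod_wt {n : ℕ} (z : ℝ≥0∞) (p : AT n → Prop) (l : List (AT n)) :
    (l.map (wt z p)).prod = open Classical in if ∀ t ∈ l, p t then z ^ sizeList l else 0 := by
  classical
  induction l with
  | nil => simp [sizeList]
  | cons a l ih =>
    rw [List.map_cons, List.prod_cons, ih, wt]
    by_cases h1 : p a <;> by_cases h2 : ∀ t ∈ l, p t
    · have : ∀ t ∈ a :: l, p t := by simpa [h1] using h2
      rw [if_pos h1, if_pos h2, if_pos this, sizeList, pow_add]
    · have : ¬ ∀ t ∈ a :: l, p t := fun h => h2 fun t ht => h t (by simp [ht])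
      rw [if_neg h2, if_neg this, mul_zero]
    · have : ¬ ∀ t ∈ a :: l, p t := fun h => h1 (h a (by simp))
      rw [if_neg h1, if_neg this, zero_mul]
    · have : ¬ ∀ t ∈ a :: l, p t := fun h => h1 (h a (by simp))
      rw [if_neg h1, if_neg this, zero_mul]

theorem tsum_pi_prod {α : Type*} (f : α → ℝ≥0∞) (k : ℕ) :
    ∑' v : Fin k → α, ∏ i, f (v i) = (∑' a, f a) ^ k := by
  induction k with
  | zero => simp
  | succ k ih =>
    rw [← (Fin.consEquiv (fun _ => α)).tsum_eq, ENNReal.tsum_prod', pow_succ', ← ih,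
      ← ENNReal.tsum_mul_right]
    refine tsum_congr fun a => ?_
    rw [← ENNReal.tsum_mul_left]
    refine tsum_congr fun v => ?_
    simp [Fin.prod_univ_succ, Fin.consEquiv]

theorem tsum_list {α : Type*} (f : α → ℝ≥0∞) :
    ∑' l : List α, (if 2 ≤ l.length then (l.map f).prod else 0) =
      (∑' a, f a) ^ 2 * (1 - ∑' a, f a)⁻¹ := by
  rw [← (List.equivSigmaTuple (α := α)).symm.tsum_eq, ENNReal.tsum_sigma']
  have : ∀ k : ℕ, ∑' v : Fin k → α,
      (if 2 ≤ (List.equivSigmaTuple.symm ⟨k, v⟩ : List α).length then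
        ((List.equivSigmaTuple.symm ⟨k, v⟩ : List α).map f).prod else 0) =
      if 2 ≤ k then (∑' a, f a) ^ k else 0 := by
    intro k
    by_cases hk : 2 ≤ k
    · simp [List.equivSigmaTuple, hk, List.prod_ofFn, ← tsum_pi_prod, List.map_ofFn]
    · simp [List.equivSigmaTuple, hk]
  rw [tsum_congr this, ← ENNReal.summable.sum_add_tsum_nat_add' (k := 2)]
  simp [Finset.sum_range_succ, pow_add, ENNReal.tsum_mul_right, ENNReal.tsum_geometric, mul_comm]

/-- Decomposition of a tree at its root. -/
def atEquiv (n : ℕ) : (Fin n × Bool) ⊕ (Bool × List (AT n)) ≃ AT n where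
  toFun := fun x => match x with
    | .inl p => .leaf p.1 p.2
    | .inr p => .node p.1 p.2
  invFun := fun t => match t with
    | .leaf i b => .inl (i, b)
    | .node c l => .inr (c, l)
  left_inv := by rintro (_ | _) <;> rfl
  right_inv := by rintro (_ | _) <;> rfl

theorem tsum_at {n : ℕ} (F : AT n → ℝ≥0∞) :
    ∑' t, F t = (∑' p : Fin n × Bool, F (.leaf p.1 p.2)) +
      ((∑' l, F (.node true l)) + ∑' l, F (.node false l)) := by
  rw [← (atEquiv n).tsum_eq, ENNReal.summable.tsum_sum ENNReal.summable,
    ENNReal.tsum_prod' (α := Bool) (β := List (AT n)), tsum_bool]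
  rw [add_comm (∑' l, F (.node true l))]
  rfl

/-- admissible children -/
def adm {n : ℕ} (c : Bool) (t : AT n) : Prop := WF t ∧ rootConn t ≠ some c

theorem adm_node {n : ℕ} (c d : Bool) (l : List (AT n)) :
    adm c (.node d l) ↔ d = !c ∧ 2 ≤ l.length ∧ ∀ t ∈ l, adm (!c) t := by
  constructor
  · rintro ⟨h, h2⟩
    cases h with
    | node _ _ a b e =>
      have : d = !c := by
        cases c <;> cases d <;> simp_all [rootConn]
      subst this
      exact ⟨rfl, a, fun t ht => ⟨b t ht, e t ht⟩⟩
  · rintro ⟨rfl, a, h⟩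
    refine ⟨.node _ _ a (fun t ht => (h t ht).1) (fun t ht => (h t ht).2), ?_⟩
    simp [rootConn]

theorem adm_leaf {n : ℕ} (c : Bool) (i : Fin n) (b : Bool) : adm c (.leaf i b) :=
  ⟨.leaf i b, by simp [rootConn]⟩

theorem wt_node {n : ℕ} (z : ℝ≥0∞) (c d : Bool) (l : List (AT n)) :
    wt z (adm c) (.node d l) = if d = !c then
      z * (if 2 ≤ l.length then (l.map (wt z (adm (!c)))).prod else 0) else 0 := by
  classical
  rw [prod_wt, wt]
  simp only [adm_node]
  by_cases h1 : d = !c <;> by_cases h2 : 2 ≤ l.length <;> by_cases h3 : ∀ t ∈ l, adm (!c) t <;>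
    simp [h1, h2, h3, size, pow_add, -not_forall]

theorem size_le_sizeList {n : ℕ} (l : List (AT n)) : ∀ t ∈ l, size t ≤ sizeList l := by
  induction l with
  | nil => simp
  | cons a l ih =>
    intro t ht
    rw [sizeList]
    rcases List.mem_cons.1 ht with rfl | h
    · omega
    · have := ih t h; omega

theorem wt_node_le {n : ℕ} (z : ℝ≥0∞) (N : ℕ) (c d : Bool) (l : List (AT n)) :
    wt z (fun t => adm c t ∧ size t ≤ N + 1) (.node d l) ≤ if d = !c then
      z * (if 2 ≤ l.length then
        (l.map (wt z (fun t => adm (!c) t ∧ size t ≤ N))).prod else 0) else 0 := by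
  classical
  rw [prod_wt, wt]
  split_ifs with h h1 h2 h3 h3 h3
  · simp [size, pow_add]
  · exfalso
    apply h3
    intro t ht
    refine ⟨((adm_node _ _ _).1 h.1).2.2 t ht, ?_⟩
    have := size_le_sizeList l t ht
    have h4 := h.2
    rw [size] at h4
    omega
  · exact absurd ((adm_node _ _ _).1 h.1).2.1 h2
  · exact absurd ((adm_node _ _ _).1 h.1).1 h1
  all_goals exact zero_le

theorem tsum_leaf {n : ℕ} (z : ℝ≥0∞) :
    (∑' _p : Fin n × Bool, z) = 2 * n * z := by
  rw [ENNReal.tsum_const]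
  simp [mul_comm]

theorem tsum_ite_node {n : ℕ} (z : ℝ≥0∞) (c : Bool) (f : AT n → ℝ≥0∞) (G : ℝ≥0∞)
    (hG : G = z * ((∑' a, f a) ^ 2 * (1 - ∑' a, f a)⁻¹)) :
    (∑' l : List (AT n), (if true = !c then
      z * (if 2 ≤ l.length then (l.map f).prod else 0) else 0)) +
    (∑' l : List (AT n), (if false = !c then
      z * (if 2 ≤ l.length then (l.map f).prod else 0) else 0)) = G := by
  rw [hG, ← tsum_list, ← ENNReal.tsum_mul_left]
  cases c <;> simp

theorem S_eq {n : ℕ} (z : ℝ≥0∞) (c : Bool) :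
    ∑' t : AT n, wt z (adm c) t = 2 * n * z +
      z * ((∑' t : AT n, wt z (adm (!c)) t) ^ 2 * (1 - ∑' t : AT n, wt z (adm (!c)) t)⁻¹) := by
  rw [tsum_at]
  simp only [wt_node]
  rw [tsum_ite_node z c _ _ rfl, ← tsum_leaf]
  simp [wt, adm_leaf, size]

theorem SN_le {n : ℕ} (z : ℝ≥0∞) (N : ℕ) (c : Bool) :
    ∑' t : AT n, wt z (fun t => adm c t ∧ size t ≤ N + 1) t ≤ 2 * n * z +
      z * ((∑' t : AT n, wt z (fun t => adm (!c) t ∧ size t ≤ N) t) ^ 2 *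
        (1 - ∑' t : AT n, wt z (fun t => adm (!c) t ∧ size t ≤ N) t)⁻¹) := by
  rw [tsum_at, ← tsum_ite_node z c _ _ rfl, ← tsum_leaf]
  refine add_le_add (le_of_eq ?_) (add_le_add ?_ ?_)
  · simp [wt, adm_leaf, size]
  · exact ENNReal.tsum_le_tsum fun l => wt_node_le z N c true l
  · exact ENNReal.tsum_le_tsum fun l => wt_node_le z N c false l

theorem size_pos {n : ℕ} (t : AT n) : 0 < size t := by
  cases t <;> simp [size]

theorem S_le {n : ℕ} (z Y : ℝ≥0∞) (hY : 2 * n * z + z * (Y ^ 2 * (1 - Y)⁻¹) ≤ Y) (c : Bool) :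
    ∑' t : AT n, wt z (adm c) t ≤ Y := by
  have key : ∀ N c, ∑' t : AT n, wt z (fun t => adm c t ∧ size t ≤ N) t ≤ Y := by
    intro N
    induction N with
    | zero =>
      intro c
      have : ∀ t : AT n, wt z (fun t => adm c t ∧ size t ≤ 0) t = 0 := by
        intro t
        have := size_pos t
        rw [wt, if_neg]
        rintro ⟨_, h⟩
        omega
      rw [tsum_congr this, tsum_zero]
      exact zero_le
    | succ N ih =>
      intro c
      refine (SN_le z N c).trans (le_trans ?_ hY)
      gcongr <;> exact ih _
  rw [ENNReal.tsum_eq_iSup_sum]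
  refine iSup_le fun s => ?_
  refine le_trans ?_ (key (s.sup size) c)
  refine le_trans (Finset.sum_le_sum fun t ht => ?_) (ENNReal.sum_le_tsum s)
  have h : size t ≤ s.sup size := Finset.le_sup (f := size) ht
  unfold wt
  by_cases ha : adm c t
  · rw [if_pos ha, if_pos ⟨ha, h⟩]
  · rw [if_neg ha]
    exact zero_le

theorem fin_of_tsum {n : ℕ} (z : ℝ≥0∞) (hz : z ≠ 0) (p : AT n → Prop)
    (h : ∑' t, wt z p t ≠ ∞) (m : ℕ) : Finite {t : AT n // p t ∧ size t = m} := by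
  have := ENNReal.finite_const_le_of_tsum_ne_top h (ε := z ^ m) (pow_ne_zero _ hz)
  refine (this.subset ?_).to_subtype
  rintro t ⟨h1, h2⟩
  simp [wt, h1, h2]

theorem count_sum {n : ℕ} (z : ℝ≥0∞) (p : AT n → Prop)
    (hf : ∀ m, Finite {t : AT n // p t ∧ size t = m}) :
    ∑' m, (Nat.card {t : AT n // p t ∧ size t = m} : ℝ≥0∞) * z ^ m = ∑' t, wt z p t := by
  classical
  have h1 : ∀ t : AT n, wt z p t = ∑' m, if p t ∧ size t = m then z ^ m else 0 := by
    intro t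
    rw [tsum_eq_single (size t)]
    · simp [wt]
    · intro m hm
      rw [if_neg]
      rintro ⟨_, rfl⟩
      exact hm rfl
  rw [tsum_congr h1, ENNReal.tsum_comm]
  refine tsum_congr fun m => ?_
  have := hf m
  have h2 := tsum_subtype {t : AT n | p t ∧ size t = m} (fun _ => z ^ m)
  simp only [Set.indicator, Set.mem_ofPred_eq] at h2
  rw [← h2, ENNReal.tsum_const]
  congr 1
  have : Finite ({t : AT n | p t ∧ size t = m} : Set (AT n)) := hf m
  rw [ENat.card_eq_coe_natCard]
  rfl

/-- The real closed form. -/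
noncomputable def yy (n : ℕ) (z : ℝ) : ℝ :=
  (2 * n * z + 1 - Real.sqrt ((4 * (n : ℝ) ^ 2 - 8 * n) * z ^ 2 - 4 * n * z + 1))
        / (2 * (z + 1))

theorem rho_facts (n : ℕ) (hn : 3 ≤ n) (z : ℝ) (hz0 : 0 ≤ z) (hz : z < rho n) :
    2 * n * z < 1 ∧ 0 ≤ (4 * (n : ℝ) ^ 2 - 8 * n) * z ^ 2 - 4 * n * z + 1 := by
  have hn' : (3 : ℝ) ≤ n := by exact_mod_cast hn
  have hs := Real.sqrt_nonneg (2 * (n : ℝ))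
  have hs2 := Real.sq_sqrt (show 0 ≤ 2 * (n : ℝ) by linarith)
  unfold rho at hz
  rw [lt_div_iff₀ (by positivity)] at hz
  set s := Real.sqrt (2 * (n : ℝ))
  have h0 : 0 ≤ z * s := by positivity
  have h1 : 2 * n * z < 1 := by nlinarith
  refine ⟨h1, ?_⟩
  have : (4 * (n : ℝ) ^ 2 - 8 * n) * z ^ 2 - 4 * n * z + 1
      = (1 - 2 * n * z - 2 * (z * s)) * (1 - 2 * n * z + 2 * (z * s)) := by
    linear_combination (4 * z ^ 2) * hs2
  rw [this]
  apply mul_nonneg <;> nlinarith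

theorem yy_facts (n : ℕ) (hn : 3 ≤ n) (z : ℝ) (hz0 : 0 ≤ z) (hz : z < rho n) :
    0 ≤ yy n z ∧ yy n z < 1 ∧ 2 * n * z + z * (yy n z ^ 2 * (1 - yy n z)⁻¹) = yy n z ∧
    ∀ s ≤ yy n z, s = 2 * n * z + z * (s ^ 2 * (1 - s)⁻¹) → s = yy n z := by
  obtain ⟨h1, hD⟩ := rho_facts n hn z hz0 hz
  have hn' : (3 : ℝ) ≤ n := by exact_mod_cast hn
  have hy : 2 * (z + 1) * yy n z = 2 * n * z + 1 -
      Real.sqrt ((4 * (n : ℝ) ^ 2 - 8 * n) * z ^ 2 - 4 * n * z + 1) := by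
    unfold yy
    field_simp
  have hr0 := Real.sqrt_nonneg ((4 * (n : ℝ) ^ 2 - 8 * n) * z ^ 2 - 4 * n * z + 1)
  have hr2 := Real.sq_sqrt hD
  have hnz : 0 ≤ n * z := by positivity
  have hle : Real.sqrt ((4 * (n : ℝ) ^ 2 - 8 * n) * z ^ 2 - 4 * n * z + 1) ≤ 2 * n * z + 1 := by
    apply Real.sqrt_le_iff.2
    constructor
    · nlinarith
    · nlinarith [mul_nonneg hnz hz0]
  set r := Real.sqrt ((4 * (n : ℝ) ^ 2 - 8 * n) * z ^ 2 - 4 * n * z + 1)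
  set y := yy n z
  have y0 : 0 ≤ y := by
    by_contra h
    push Not at h
    nlinarith
  have y1 : y < 1 := by
    by_contra h
    push Not at h
    nlinarith
  have hr : r = 2 * n * z + 1 - 2 * (z + 1) * y := by linarith
  have hquad : (1 + z) * y ^ 2 - (1 + 2 * n * z) * y + 2 * n * z = 0 := by
    rw [hr] at hr2
    have : 4 * (1 + z) * ((1 + z) * y ^ 2 - (1 + 2 * n * z) * y + 2 * n * z) = 0 := by
      linear_combination hr2
    rcases mul_eq_zero.1 this with h | h
    · nlinarith
    · exact h
  refine ⟨y0, y1, ?_, ?_⟩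
  · have : 1 - y ≠ 0 := by linarith
    field_simp
    linear_combination hquad
  · intro s hs he
    have : 1 - s ≠ 0 := by linarith
    field_simp at he
    have hq : (1 + z) * s ^ 2 - (1 + 2 * n * z) * s + 2 * n * z = 0 := by
      linear_combination -he
    by_contra hne
    have hlt : s < y := lt_of_le_of_ne hs hne
    have h3 : (y - s) * ((1 + z) * (s + y) - (1 + 2 * n * z)) = 0 := by
      linear_combination hquad - hq
    rcases mul_eq_zero.1 h3 with h | h
    · linarith
    · nlinarith

theorem main_sum (n : ℕ) (hn : 3 ≤ n) (z : ℝ) (hz0 : 0 ≤ z) (hz : z < rho n) (c : Bool) :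
    ∑' t : AT n, wt (ENNReal.ofReal z) (adm c) t = ENNReal.ofReal (yy n z) := by
  obtain ⟨y0, y1, hy, hu⟩ := yy_facts n hn z hz0 hz
  have conv : ∀ s : ℝ, 0 ≤ s → s < 1 →
      2 * (n : ℝ≥0∞) * ENNReal.ofReal z + ENNReal.ofReal z *
        ((ENNReal.ofReal s) ^ 2 * (1 - ENNReal.ofReal s)⁻¹) =
      ENNReal.ofReal (2 * n * z + z * (s ^ 2 * (1 - s)⁻¹)) := by
    intro s s0 s1
    have : 0 < 1 - s := by linarith
    rw [ENNReal.ofReal_add (by positivity) (by positivity), ENNReal.ofReal_mul (by positivity),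
      ENNReal.ofReal_mul (by positivity), ENNReal.ofReal_mul (by positivity),
      ENNReal.ofReal_mul (by positivity), ENNReal.ofReal_inv_of_pos this,
      ENNReal.ofReal_sub _ s0, ENNReal.ofReal_pow s0]
    simp
  have hle : ∀ c, ∑' t : AT n, wt (ENNReal.ofReal z) (adm c) t ≤ ENNReal.ofReal (yy n z) :=
    S_le _ _ (by rw [conv _ y0 y1, hy])
  have hlift : ∀ c, ∃ s : ℝ, 0 ≤ s ∧ s ≤ yy n z ∧
      ∑' t : AT n, wt (ENNReal.ofReal z) (adm c) t = ENNReal.ofReal s := by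
    intro c
    have hfin := ne_top_of_le_ne_top ENNReal.ofReal_ne_top (hle c)
    refine ⟨_, ENNReal.toReal_nonneg, ?_, (ENNReal.ofReal_toReal hfin).symm⟩
    exact ENNReal.toReal_le_of_le_ofReal y0 (hle c)
  choose s s0 sy hs using hlift
  have heq : ∀ c, s c = 2 * n * z + z * (s (!c) ^ 2 * (1 - s (!c))⁻¹) := by
    intro c
    have h := S_eq (n := n) (ENNReal.ofReal z) c
    have : 0 < 1 - s (!c) := by linarith [sy (!c)]
    have := s0 (!c)
    rw [hs, hs, conv _ (s0 _) ((sy _).trans_lt y1),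
      ENNReal.ofReal_eq_ofReal_iff (s0 _) (by positivity)] at h
    exact h
  have mono : ∀ c, s c ≤ s (!c) := by
    intro c
    by_contra hlt
    push Not at hlt
    have e1 := heq c
    have e2 := heq (!c)
    rw [Bool.not_not] at e2
    have : 0 < 1 - s c := by linarith [sy c]
    have : 0 < 1 - s (!c) := by linarith [sy (!c)]
    have := s0 (!c)
    have : z * (s (!c) ^ 2 * (1 - s (!c))⁻¹) ≤ z * (s c ^ 2 * (1 - s c)⁻¹) := by
      gcongr
    linarith
  have hsym : s (!c) = s c := by
    refine le_antisymm ?_ (mono c)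
    simpa using mono (!c)
  have h := heq c
  rw [hsym] at h
  rw [hs, hu _ (sy c) h]

theorem sum_all {n : ℕ} (z : ℝ≥0∞) :
    ∑' t : AT n, wt z WF t + 2 * n * z =
      ∑' t : AT n, wt z (adm true) t + ∑' t : AT n, wt z (adm false) t := by
  classical
  have : 2 * n * z = ∑' t : AT n, wt z (fun t => rootConn t = none) t := by
    rw [tsum_at, ← tsum_leaf]
    simp [wt, rootConn, size]
  rw [this, ← ENNReal.tsum_add, ← ENNReal.tsum_add]
  refine tsum_congr fun t => ?_
  cases t with
  | leaf i b => simp [wt, rootConn, adm_leaf, WF.leaf]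
  | node d l => cases d <;> simp [wt, rootConn, adm]

theorem to_real (a : ℕ → ℕ) (z s : ℝ) (hz0 : 0 ≤ z) (hs : 0 ≤ s)
    (h : ∑' m, (a m : ℝ≥0∞) * ENNReal.ofReal z ^ m = ENNReal.ofReal s) :
    HasSum (fun m => (a m : ℝ) * z ^ m) s := by
  have h2 := ENNReal.hasSum_toReal (h.trans_ne ENNReal.ofReal_ne_top)
  rw [← ENNReal.tsum_toReal_eq, h, ENNReal.toReal_ofReal hs] at h2
  · simpa [hz0] using h2
  · exact fun m => ENNReal.mul_ne_top (by simp) (by simp)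

theorem rho_pos (n : ℕ) (hn : 3 ≤ n) : 0 < rho n := by
  have hn' : (3 : ℝ) ≤ n := by exact_mod_cast hn
  unfold rho
  positivity

end helpers

/-- For `n ≥ 3` and `0 ≤ z < ρ`, the series `Â(z)` converges and equals
`(2nz + 1 − √((4n² − 8n)z² − 4nz + 1))/(2(z+1))`, and `A(z)` converges and equals
`2Â(z) − 2nz`. -/
theorem statement4 (n : ℕ) (hn : 3 ≤ n) (z : ℝ) (hz0 : 0 ≤ z) (hz : z < rho n) :
    Summable (fun m : ℕ => (Ahat n m : ℝ) * z ^ m) ∧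
    (∑' m : ℕ, (Ahat n m : ℝ) * z ^ m) =
      (2 * n * z + 1 - Real.sqrt ((4 * (n : ℝ) ^ 2 - 8 * n) * z ^ 2 - 4 * n * z + 1))
        / (2 * (z + 1)) ∧
    Summable (fun m : ℕ => (A n m : ℝ) * z ^ m) ∧
    (∑' m : ℕ, (A n m : ℝ) * z ^ m) =
      2 * (∑' m : ℕ, (Ahat n m : ℝ) * z ^ m) - 2 * n * z := by
  obtain ⟨y0, y1, hy, hu⟩ := yy_facts n hn z hz0 hz
  have hρ := rho_pos n hn
  have hall : ∀ w : ℝ, 0 ≤ w → w < rho n →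
      ∑' t : AT n, wt (ENNReal.ofReal w) WF t = ENNReal.ofReal (2 * yy n w - 2 * n * w) := by
    intro w w0 hw
    have h := sum_all (n := n) (ENNReal.ofReal w)
    have e : 2 * (n : ENNReal) * ENNReal.ofReal w = ENNReal.ofReal (2 * n * w) := by
      rw [ENNReal.ofReal_mul (by positivity), ENNReal.ofReal_mul (by positivity)]
      simp
    have hy0 := (yy_facts n hn w w0 hw).1
    rw [main_sum n hn w w0 hw, main_sum n hn w w0 hw, ← ENNReal.ofReal_add hy0 hy0, e] at h
    rw [ENNReal.ofReal_sub _ (by positivity), two_mul (yy n w)]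
    exact ENNReal.eq_sub_of_add_eq ENNReal.ofReal_ne_top h
  have hfinW : ∀ m, Finite {t : AT n // WF t ∧ size t = m} :=
    fin_of_tsum (ENNReal.ofReal (rho n / 2)) (by simpa using hρ) WF
      (by rw [hall _ (by linarith) (by linarith)]; exact ENNReal.ofReal_ne_top)
  have hfinA : ∀ m, Finite {t : AT n // adm false t ∧ size t = m} := fun m =>
    have := hfinW m
    Finite.of_injective (β := {t : AT n // WF t ∧ size t = m})
      (fun t => ⟨t.1, t.2.1.1, t.2.2⟩) (fun a b h => by
        simpa [Subtype.ext_iff] using h)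
  have hAc : ∀ m, A n m = Nat.card {t : AT n // WF t ∧ size t = m} := by
    intro m
    unfold A countIn
    simp
  have hAhc : ∀ m, Ahat n m = Nat.card {t : AT n // adm false t ∧ size t = m} := by
    intro m
    unfold Ahat countIn
    refine Nat.card_congr (Equiv.subtypeEquivRight fun t => ?_)
    simp only [adm, Set.mem_ofPred_eq]
    tauto
  have hyn : 0 ≤ 2 * yy n z - 2 * n * z := by
    have h3 : 0 < 1 - yy n z := by linarith
    have h4 : 0 ≤ z * (yy n z ^ 2 * (1 - yy n z)⁻¹) := by positivity
    linarith
  have s1 : HasSum (fun m : ℕ => (Ahat n m : ℝ) * z ^ m) (yy n z) := by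
    apply to_real _ _ _ hz0 y0
    rw [← main_sum n hn z hz0 hz false, ← count_sum _ _ hfinA]
    simp only [hAhc]
  have s2 : HasSum (fun m : ℕ => (A n m : ℝ) * z ^ m) (2 * yy n z - 2 * n * z) := by
    apply to_real _ _ _ hz0 hyn
    rw [← hall z hz0 hz, ← count_sum _ _ hfinW]
    simp only [hAc]
  exact ⟨s1.summable, s1.tsum_eq, s2.summable, by rw [s2.tsum_eq, s1.tsum_eq]⟩
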